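/- arXiv:1903.10990 — 2 statements merged into one kernel-verified Lean document; each statement's English description precedes it below -/
import Mathlib

section
/- Let n ≥ 7 and set L₂(y) := (|y|² - 1)/[(1+yₙ)² + |ȳ|²]^{n} for y = (ȳ, yₙ) ∈ ℝⁿ₊. Then ∫_{ℝⁿ₊} L₂(y)·yₙ⁴ dy = ω_{n-2}·240/((n-1)(n-2)(n-3)(n-4)(n-5)(n-6))·Iₙⁿ. -/
open MeasureTheory

noncomputable section

/-- The index of the last coordinate in `Fin n`. -/
def lastIdx (n : ℕ) [NeZero n] : Fin n :=
  ⟨n - 1, Nat.sub_lt (Nat.pos_of_ne_zero (NeZero.ne n)) Nat.one_pos⟩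

/-- The last coordinate `yₙ` of a point `y ∈ ℝⁿ`. -/
def lastCoord (n : ℕ) [NeZero n] (y : EuclideanSpace ℝ (Fin n)) : ℝ :=
  y (lastIdx n)

/-- `|ȳ|²`, the squared norm of the first `n-1` coordinates. -/
def barNormSq (n : ℕ) [NeZero n] (y : EuclideanSpace ℝ (Fin n)) : ℝ :=
  ∑ i : Fin n, if (i : ℕ) < n - 1 then (y i) ^ 2 else 0

/-- The closed upper half-space `ℝⁿ₊ = {y : yₙ ≥ 0}`. -/
def halfSpace (n : ℕ) [NeZero n] : Set (EuclideanSpace ℝ (Fin n)) :=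
  {y | 0 ≤ lastCoord n y}

/-- The surface measure of the unit sphere `S^{d-1} ⊂ ℝ^d`, expressed as
`d · vol(B₁^d)`. For `d = n-1` this is `ω_{n-2}`, the area of `S^{n-2} ⊂ ℝ^{n-1}`. -/
def sphereArea (d : ℕ) : ℝ :=
  (d : ℝ) * (volume (Metric.ball (0 : EuclideanSpace ℝ (Fin d)) 1)).toReal

/-- `I_m^α := ∫₀^∞ s^α/(1+s²)^m ds`; in particular `Iint n n = Iₙⁿ`. -/
def Iint (m α : ℕ) : ℝ := ∫ s in Set.Ioi (0 : ℝ), s ^ α / (1 + s ^ 2) ^ m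

/-- `L₁(y) = (|y|²-1)/((1+yₙ)²+|ȳ|²)^{n+1}`. -/
def L1 (n : ℕ) [NeZero n] (y : EuclideanSpace ℝ (Fin n)) : ℝ :=
  (‖y‖ ^ 2 - 1) / ((1 + lastCoord n y) ^ 2 + barNormSq n y) ^ (n + 1)

/-- `L₂(y) = (|y|²-1)/((1+yₙ)²+|ȳ|²)^{n}`. -/
def L2 (n : ℕ) [NeZero n] (y : EuclideanSpace ℝ (Fin n)) : ℝ :=
  (‖y‖ ^ 2 - 1) / ((1 + lastCoord n y) ^ 2 + barNormSq n y) ^ n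

/-- `L₃(y) = (|y|²-1)/((1+yₙ)²+|ȳ|²)^{n-1}`. -/
def L3 (n : ℕ) [NeZero n] (y : EuclideanSpace ℝ (Fin n)) : ℝ :=
  (‖y‖ ^ 2 - 1) / ((1 + lastCoord n y) ^ 2 + barNormSq n y) ^ (n - 1)

open Set Filter Topology

/-- Comparison with `(1+x²)⁻¹` on the half-line. -/
lemma intOn_of_le {f : ℝ → ℝ} (hf : Measurable f)
    (h : ∀ x : ℝ, 0 < x → |f x| ≤ (1 + x ^ 2)⁻¹) : IntegrableOn f (Ioi 0) := by
  refine (integrable_inv_one_add_sq.integrableOn (s := Ioi (0 : ℝ))).mono'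
    hf.aestronglyMeasurable ?_
  filter_upwards [ae_restrict_mem measurableSet_Ioi] with x hx
  exact h x hx

lemma intOn_J (k p : ℕ) :
    IntegrableOn (fun t : ℝ => t ^ k / (1 + t) ^ (k + p + 2)) (Ioi 0) := by
  refine intOn_of_le (by fun_prop) fun x hx => ?_
  rw [abs_of_nonneg (by positivity), inv_eq_one_div, div_le_div_iff₀ (by positivity) (by positivity)]
  have h1 : x ^ k ≤ (1 + x) ^ (k + p) :=
    (pow_le_pow_left₀ hx.le (by linarith) k).trans
      (pow_le_pow_right₀ (by linarith) (by omega))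
  have h2 : 1 + x ^ 2 ≤ (1 + x) ^ 2 := by nlinarith
  rw [one_mul, pow_add _ (k + p) 2]
  exact mul_le_mul h1 h2 (by positivity) (by positivity)

lemma tendsto_J (k p : ℕ) :
    Tendsto (fun t : ℝ => t ^ k / (1 + t) ^ (k + p + 1)) atTop (𝓝 0) := by
  refine squeeze_zero' (g := fun t : ℝ => t⁻¹) ?_ ?_ tendsto_inv_atTop_zero
  · filter_upwards [eventually_gt_atTop 0] with t ht
    positivity
  · filter_upwards [eventually_gt_atTop 0] with x hx
    rw [inv_eq_one_div, div_le_div_iff₀ (by positivity) (by positivity), one_mul, ← pow_succ]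
    exact (pow_le_pow_left₀ hx.le (by linarith) (k + 1)).trans
      (pow_le_pow_right₀ (by linarith) (by omega))

lemma J_zero (p : ℕ) : ∫ t in Ioi (0 : ℝ), t ^ 0 / (1 + t) ^ (0 + p + 2) = 1 / ((p : ℝ) + 1) := by
  have hp : (p : ℝ) + 1 ≠ 0 := by positivity
  have := integral_Ioi_of_hasDerivAt_of_tendsto' (a := 0) (m := 0)
    (f := fun t : ℝ => -(1 / ((p : ℝ) + 1)) * (t ^ 0 / (1 + t) ^ (0 + p + 1)))
    (f' := fun t : ℝ => t ^ 0 / (1 + t) ^ (0 + p + 2)) ?_ (intOn_J 0 p) ?_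
  · rw [this]; simp
  · intro x hx
    have hx : 0 ≤ x := hx
    have h1 : (1 + x) ≠ 0 := by positivity
    have h := ((((hasDerivAt_id x).const_add 1).pow (p + 1)).inv (by simpa using h1)).const_mul
      (-(1 / ((p : ℝ) + 1)))
    convert! h using 1
    · ext t; simp
    · simp; field_simp
      ring
  · simpa using (tendsto_J 0 p).const_mul (-(1 / ((p : ℝ) + 1)))

lemma J_succ (k p : ℕ) : ∫ t in Ioi (0 : ℝ), t ^ (k + 1) / (1 + t) ^ (k + 1 + p + 2) =
    ((k : ℝ) + 1) / ((k : ℝ) + p + 2) * ∫ t in Ioi (0 : ℝ), t ^ k / (1 + t) ^ (k + p + 2) := by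
  have hp : (k : ℝ) + p + 2 ≠ 0 := by positivity
  have hi1 := (intOn_J k p).const_mul ((k : ℝ) + 1)
  have hi2 := (intOn_J (k + 1) p).const_mul ((k : ℝ) + p + 2)
  have := integral_Ioi_of_hasDerivAt_of_tendsto' (a := 0) (m := 0)
    (f := fun t : ℝ => t ^ (k + 1) / (1 + t) ^ (k + 1 + p + 1))
    (f' := fun t : ℝ => ((k : ℝ) + 1) * (t ^ k / (1 + t) ^ (k + p + 2)) -
      ((k : ℝ) + p + 2) * (t ^ (k + 1) / (1 + t) ^ (k + 1 + p + 2))) ?_ (hi1.sub hi2)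
      (tendsto_J (k + 1) p)
  · rw [integral_sub hi1 hi2, integral_const_mul, integral_const_mul] at this
    simp at this
    field_simp
    linarith
  · intro x hx
    have hx : 0 ≤ x := hx
    have h1 : (1 + x) ≠ 0 := by positivity
    have h := ((hasDerivAt_id x).pow (k + 1)).div
      (((hasDerivAt_id x).const_add 1).pow (k + 1 + p + 1)) (by simpa using h1)
    convert! h using 1
    simp
    have e1 : k + p + 2 = (k + 1 + p) + 1 := by ring
    have e2 : k + 1 + p + 2 = (k + 1 + p) + 1 + 1 := by ring
    rw [e1, e2]
    field_simp
    ring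

lemma J_five (p : ℕ) : ∫ t in Ioi (0 : ℝ), t ^ 5 / (1 + t) ^ (p + 7) =
    120 / (((p : ℝ) + 6) * (p + 5) * (p + 4) * (p + 3) * (p + 2) * (p + 1)) := by
  have h := J_succ 4 p
  rw [J_succ 3 p, J_succ 2 p, J_succ 1 p, J_succ 0 p, J_zero p] at h
  rw [show 4 + 1 + p + 2 = p + 7 by ring] at h
  norm_num at h
  rw [h]
  field_simp
  ring

/-- Integrability for the radial integrals, `n = m+2`. -/
lemma intOn_I (m j : ℕ) (hj : j ≤ 2) :
    IntegrableOn (fun s : ℝ => s ^ (m + j) / (1 + s ^ 2) ^ (m + 2)) (Ioi 0) := by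
  refine intOn_of_le (by fun_prop) fun x hx => ?_
  rw [abs_of_nonneg (by positivity), inv_eq_one_div, div_le_div_iff₀ (by positivity) (by positivity)]
  have h1 : x ^ m ≤ (1 + x ^ 2) ^ m :=
    pow_le_pow_left₀ hx.le (by nlinarith [sq_nonneg (x - 1)]) m
  have h2 : x ^ j ≤ 1 + x ^ 2 := by
    interval_cases j <;> nlinarith [sq_nonneg (x - 1)]
  calc x ^ (m + j) * (1 + x ^ 2) = x ^ m * x ^ j * (1 + x ^ 2) := by ring
    _ ≤ (1 + x ^ 2) ^ m * (1 + x ^ 2) * (1 + x ^ 2) := by gcongr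
    _ = _ := by ring

lemma I_symm (m : ℕ) : ∫ s in Ioi (0 : ℝ), s ^ m / (1 + s ^ 2) ^ (m + 2) =
    ∫ s in Ioi (0 : ℝ), s ^ (m + 2) / (1 + s ^ 2) ^ (m + 2) := by
  have hi1 := intOn_I m 0 (by norm_num)
  have hi2 := intOn_I m 2 (by norm_num)
  simp only [add_zero] at hi1
  have := integral_Ioi_of_hasDerivAt_of_tendsto' (a := 0) (m := 0)
    (f := fun s : ℝ => (1 / ((m : ℝ) + 1)) * (s ^ (m + 1) / (1 + s ^ 2) ^ (m + 1)))
    (f' := fun s : ℝ => s ^ m / (1 + s ^ 2) ^ (m + 2) - s ^ (m + 2) / (1 + s ^ 2) ^ (m + 2))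
    ?_ (hi1.sub hi2) ?_
  · rw [integral_sub hi1 hi2] at this
    simp at this
    linarith
  · intro x hx
    have h1 : (1 + x ^ 2) ≠ 0 := by positivity
    have h := (((hasDerivAt_id x).pow (m + 1)).div
      ((((hasDerivAt_id x).pow 2).const_add 1).pow (m + 1)) (by simpa using h1)).const_mul
      (1 / ((m : ℝ) + 1))
    convert! h using 1
    simp
    field_simp
    ring
  · have : Tendsto (fun s : ℝ => s ^ (m + 1) / (1 + s ^ 2) ^ (m + 1)) atTop (𝓝 0) := by
      refine squeeze_zero' (g := fun t : ℝ => t⁻¹) ?_ ?_ tendsto_inv_atTop_zero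
      · filter_upwards [eventually_gt_atTop 0] with t ht
        positivity
      · filter_upwards [eventually_gt_atTop 0] with x hx
        rw [inv_eq_one_div, div_le_div_iff₀ (by positivity) (by positivity)]
        have h1 : x ^ m ≤ (1 + x ^ 2) ^ m :=
          pow_le_pow_left₀ hx.le (by nlinarith [sq_nonneg (x - 1)]) m
        calc x ^ (m + 1) * x = x ^ m * x ^ 2 := by ring
          _ ≤ (1 + x ^ 2) ^ m * (1 + x ^ 2) := by gcongr; linarith
          _ = _ := by ring
    simpa using this.const_mul (1 / ((m : ℝ) + 1))

lemma radial (m : ℕ) (t : ℝ) (ht : 0 ≤ t) :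
    ∫ r in Ioi (0 : ℝ), r ^ m * ((r ^ 2 + t ^ 2 - 1) / ((1 + t) ^ 2 + r ^ 2) ^ (m + 2)) =
      2 * t / (1 + t) ^ (m + 2) * Iint (m + 2) (m + 2) := by
  have ha : 0 < 1 + t := by linarith
  have hi1 := intOn_I m 0 (by norm_num)
  have hi2 := intOn_I m 2 (by norm_num)
  simp only [add_zero] at hi1
  have h := integral_comp_mul_left_Ioi'
    (fun r : ℝ => r ^ m * ((r ^ 2 + t ^ 2 - 1) / ((1 + t) ^ 2 + r ^ 2) ^ (m + 2))) 0 ha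
  rw [mul_zero] at h
  rw [← h, smul_eq_mul, Iint]
  have e : ∀ s : ℝ, ((1 + t) * s) ^ m * ((((1 + t) * s) ^ 2 + t ^ 2 - 1) /
      ((1 + t) ^ 2 + ((1 + t) * s) ^ 2) ^ (m + 2)) =
      1 / (1 + t) ^ (m + 2) * (s ^ (m + 2) / (1 + s ^ 2) ^ (m + 2)) +
      (t - 1) / (1 + t) ^ (m + 3) * (s ^ m / (1 + s ^ 2) ^ (m + 2)) := by
    intro s
    have hs : 0 < 1 + s ^ 2 := by positivity
    rw [show (1 + t) ^ 2 + ((1 + t) * s) ^ 2 = (1 + t) ^ 2 * (1 + s ^ 2) by ring,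
      show ((1 + t) * s) ^ 2 + t ^ 2 - 1 = (1 + t) * ((1 + t) * s ^ 2 + (t - 1)) by ring,
      mul_pow, mul_pow, ← pow_mul, show 2 * (m + 2) = m + 1 + (m + 3) by ring,
      pow_add _ (m + 1)]
    field_simp
    ring
  simp only [e]
  rw [integral_add (hi2.const_mul _) (hi1.const_mul _), integral_const_mul, integral_const_mul,
    I_symm m]
  field_simp
  ring

/-- The splitting `y ↦ (yₙ, ȳ)`. -/
def splitE (d : ℕ) : EuclideanSpace ℝ (Fin (d + 1)) ≃ᵐ ℝ × EuclideanSpace ℝ (Fin d) :=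
  (MeasurableEquiv.toLp 2 (Fin (d + 1) → ℝ)).symm.trans
    ((MeasurableEquiv.piFinSuccAbove (fun _ => ℝ) (Fin.last d)).trans
      (MeasurableEquiv.prodCongr (MeasurableEquiv.refl ℝ) (MeasurableEquiv.toLp 2 (Fin d → ℝ))))

lemma splitE_mp (d : ℕ) : MeasurePreserving (splitE d) := by
  have h1 := PiLp.volume_preserving_ofLp (Fin (d + 1))
  have h2 := volume_preserving_piFinSuccAbove (fun _ : Fin (d + 1) => ℝ) (Fin.last d)
  have h3 := (MeasurePreserving.id (volume : Measure ℝ)).prod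
    (PiLp.volume_preserving_toLp (Fin d))
  exact h3.comp (h2.comp h1)

lemma splitE_fst (d : ℕ) (y : EuclideanSpace ℝ (Fin (d + 1))) :
    (splitE d y).1 = lastCoord (d + 1) y := rfl

lemma splitE_snd (d : ℕ) (y : EuclideanSpace ℝ (Fin (d + 1))) (i : Fin d) :
    (splitE d y).2 i = y i.castSucc := by
  rw [← Fin.succAbove_last]; rfl

lemma bar_eq (d : ℕ) (y : EuclideanSpace ℝ (Fin (d + 1))) :
    barNormSq (d + 1) y = ‖(splitE d y).2‖ ^ 2 := by
  rw [EuclideanSpace.norm_sq_eq, barNormSq, Fin.sum_univ_castSucc]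
  simp [splitE_snd]

lemma norm_eq' (d : ℕ) (y : EuclideanSpace ℝ (Fin (d + 1))) :
    ‖y‖ ^ 2 = ‖(splitE d y).2‖ ^ 2 + (splitE d y).1 ^ 2 := by
  rw [EuclideanSpace.norm_sq_eq, EuclideanSpace.norm_sq_eq, Fin.sum_univ_castSucc]
  simp only [splitE_snd, splitE_fst, Real.norm_eq_abs, sq_abs]
  rfl

/-- The integrand in split coordinates, `n = d+1`. -/
def gfun (d : ℕ) (z : ℝ × EuclideanSpace ℝ (Fin d)) : ℝ :=
  (‖z.2‖ ^ 2 + z.1 ^ 2 - 1) / ((1 + z.1) ^ 2 + ‖z.2‖ ^ 2) ^ (d + 1) * z.1 ^ 4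

lemma gfun_split (d : ℕ) (y : EuclideanSpace ℝ (Fin (d + 1))) :
    L2 (d + 1) y * lastCoord (d + 1) y ^ 4 = gfun d (splitE d y) := by
  rw [L2, gfun, bar_eq, norm_eq', splitE_fst]

lemma half_eq (d : ℕ) : halfSpace (d + 1) = splitE d ⁻¹' (Ici 0 ×ˢ univ) := by
  ext y
  simp [halfSpace, splitE_fst]

lemma gfun_int (p : ℕ) : IntegrableOn (gfun (p + 6)) (Ici 0 ×ˢ univ) := by
  rw [← (splitE_mp (p + 6)).integrableOn_comp_preimage (splitE (p + 6)).measurableEmbedding]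
  have hI : Integrable (fun x : EuclideanSpace ℝ (Fin (p + 6 + 1)) =>
      ((1 : ℝ) + ‖x‖ ^ 2) ^ (-(2 * (p + 4) : ℝ) / 2)) :=
    integrable_rpow_neg_one_add_norm_sq (by simp; linarith)
  refine hI.integrableOn.mono' ?_ ?_
  · have : Measurable (gfun (p + 6)) := by unfold gfun; fun_prop
    exact (this.comp (splitE (p + 6)).measurable).aestronglyMeasurable
  · have hm : MeasurableSet (splitE (p + 6) ⁻¹' (Ici 0 ×ˢ univ)) :=
      (splitE (p + 6)).measurable (measurableSet_Ici.prod MeasurableSet.univ)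
    filter_upwards [ae_restrict_mem hm] with y hy
    have hy : 0 ≤ (splitE (p + 6) y).1 := by simpa using hy
    have hN := norm_eq' (p + 6) y
    rw [Function.comp, gfun]
    set t := (splitE (p + 6) y).1
    set r := ‖(splitE (p + 6) y).2‖
    rw [show -(2 * (p + 4) : ℝ) / 2 = -((p + 4 : ℕ) : ℝ) by push_cast; ring,
      Real.rpow_neg (by positivity), Real.rpow_natCast, hN, Real.norm_eq_abs, abs_mul, abs_div,
      abs_of_nonneg (show 0 ≤ t ^ 4 by positivity),
      abs_of_nonneg (show 0 ≤ ((1 + t) ^ 2 + r ^ 2) ^ (p + 6 + 1) by positivity),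
      div_mul_eq_mul_div, inv_eq_one_div, div_le_div_iff₀ (by positivity) (by positivity)]
    set A := 1 + (r ^ 2 + t ^ 2) with hA
    have hA0 : 0 < A := by positivity
    have h1 : |r ^ 2 + t ^ 2 - 1| ≤ A := by
      rw [abs_le]; constructor <;> nlinarith [sq_nonneg r, sq_nonneg t]
    have h2 : t ^ 4 ≤ A ^ 2 := by
      rw [show t ^ 4 = (t ^ 2) ^ 2 by ring]
      exact pow_le_pow_left₀ (by positivity) (by nlinarith [sq_nonneg r]) 2
    have h3 : A ≤ (1 + t) ^ 2 + r ^ 2 := by nlinarith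
    calc |r ^ 2 + t ^ 2 - 1| * t ^ 4 * A ^ (p + 4) ≤ A * A ^ 2 * A ^ (p + 4) := by gcongr
      _ = A ^ (p + 6 + 1) := by ring
      _ ≤ ((1 + t) ^ 2 + r ^ 2) ^ (p + 6 + 1) := by gcongr
      _ = _ := by ring

lemma inner_int (p : ℕ) (t : ℝ) (ht : 0 ≤ t) :
    ∫ x : EuclideanSpace ℝ (Fin (p + 6)), gfun (p + 6) (t, x) =
      sphereArea (p + 6) * (2 * Iint (p + 7) (p + 7)) * (t ^ 5 / (1 + t) ^ (p + 7)) := by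
  simp only [gfun]
  rw [integral_mul_const,
    integral_fun_norm_addHaar volume
      (fun r : ℝ => (r ^ 2 + t ^ 2 - 1) / ((1 + t) ^ 2 + r ^ 2) ^ (p + 6 + 1))]
  simp only [finrank_euclideanSpace, Fintype.card_fin, smul_eq_mul, nsmul_eq_mul]
  have h := radial (p + 5) t ht
  rw [show p + 5 + 2 = p + 6 + 1 by ring] at h
  rw [show p + 6 - 1 = p + 5 by omega, h, sphereArea, Measure.real]
  ring

/-- `∫_{ℝⁿ₊} L₂ yₙ⁴ dy = ω_{n-2} · 240/((n-1)(n-2)(n-3)(n-4)(n-5)(n-6)) · Iₙⁿ`. -/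
theorem statement13 (n : ℕ) [NeZero n] (hn : 7 ≤ n) :
    ∫ y in halfSpace n, L2 n y * (lastCoord n y) ^ 4
      = sphereArea (n - 1)
          * (240 / (((n : ℝ) - 1) * ((n : ℝ) - 2) * ((n : ℝ) - 3) * ((n : ℝ) - 4)
              * ((n : ℝ) - 5) * ((n : ℝ) - 6)))
          * Iint n n := by
  obtain ⟨p, rfl⟩ : ∃ p, n = p + 6 + 1 := ⟨n - 7, by omega⟩
  simp only [gfun_split]
  rw [half_eq, (splitE_mp (p + 6)).setIntegral_preimage_emb (splitE (p + 6)).measurableEmbedding,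
    Measure.volume_eq_prod, setIntegral_prod _ (gfun_int p)]
  simp only [Measure.restrict_univ]
  rw [setIntegral_congr_fun measurableSet_Ici (fun t ht => inner_int p t ht),
    integral_const_mul, integral_Ici_eq_integral_Ioi, J_five, Nat.add_sub_cancel]
  push_cast
  rw [show (p : ℝ) + 6 + 1 - 1 = p + 6 by ring, show (p : ℝ) + 6 + 1 - 2 = p + 5 by ring,
    show (p : ℝ) + 6 + 1 - 3 = p + 4 by ring, show (p : ℝ) + 6 + 1 - 4 = p + 3 by ring,
    show (p : ℝ) + 6 + 1 - 5 = p + 2 by ring, show (p : ℝ) + 6 + 1 - 6 = p + 1 by ring]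
  ring
end
end

section
/- Let n ≥ 7 and set L₃(y) := (|y|² - 1)/[(1+yₙ)² + |ȳ|²]^{n-1} for y = (ȳ, yₙ) ∈ ℝⁿ₊. Then ∫_{ℝⁿ₊} L₃(y)·|ȳ|² dy = ω_{n-2}·16(n-1)/((n-3)(n-5)(n-6))·Iₙⁿ. -/
open MeasureTheory

noncomputable section

lemma aux_integrable (m α : ℕ) (h : α + 2 ≤ 2 * m) :
    IntegrableOn (fun s : ℝ => s ^ α / (1 + s ^ 2) ^ m) (Set.Ioi 0) := by
  refine Integrable.mono' integrable_inv_one_add_sq.integrableOn ?_ ?_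
  · refine Continuous.aestronglyMeasurable ?_
    refine Continuous.div (by fun_prop) (by fun_prop) (fun s => by positivity)
  · refine (ae_restrict_iff' measurableSet_Ioi).mpr (ae_of_all _ fun s hs => ?_)
    have hs : 0 < s := hs
    obtain ⟨k, rfl⟩ : ∃ k, m = k + 1 := ⟨m - 1, by omega⟩
    rw [Real.norm_of_nonneg (by positivity), inv_eq_one_div,
      div_le_div_iff₀ (by positivity) (by positivity), pow_succ, one_mul]
    refine mul_le_mul_of_nonneg_right ?_ (by positivity)
    rcases le_total s 1 with h1 | h1
    · exact (pow_le_one₀ hs.le h1).trans (one_le_pow₀ (by nlinarith))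
    · calc s ^ α ≤ s ^ (2 * k) := pow_le_pow_right₀ h1 (by omega)
        _ = (s ^ 2) ^ k := by rw [pow_mul]
        _ ≤ (1 + s ^ 2) ^ k := pow_le_pow_left₀ (by positivity) (by linarith) k

lemma aux_rec (m α : ℕ) (h : α + 2 ≤ 2 * m) :
    (2 * (m : ℝ) - α - 1) * Iint m α = 2 * m * Iint (m + 1) α := by
  have i1 := aux_integrable m α h
  have i2 := aux_integrable (m + 1) α (by omega)
  have key := integral_Ioi_of_hasDerivAt_of_tendsto (a := (0 : ℝ)) (m := (0 : ℝ))
    (f := fun s : ℝ => s ^ (α + 1) / (1 + s ^ 2) ^ m)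
    (f' := fun s : ℝ => ((α : ℝ) + 1 - 2 * m) * (s ^ α / (1 + s ^ 2) ^ m)
      + 2 * m * (s ^ α / (1 + s ^ 2) ^ (m + 1))) ?_ ?_ ?_ ?_
  · rw [integral_add (i1.const_mul _) (i2.const_mul _), integral_const_mul,
      integral_const_mul] at key
    simp only [Iint]
    simp at key
    linarith
  · refine Continuous.continuousWithinAt ?_
    exact Continuous.div (by fun_prop) (by fun_prop) (fun s => by positivity)
  · intro s hs
    have hp : (1 + s ^ 2) ≠ 0 := by positivity
    have hd := (hasDerivAt_pow (α + 1) s).div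
      ((((hasDerivAt_pow 2 s).const_add 1).pow m)) (pow_ne_zero m hp)
    refine hd.congr_deriv ?_
    obtain ⟨k, rfl⟩ : ∃ k, m = k + 1 := ⟨m - 1, by omega⟩
    simp
    field_simp
    ring
  · exact (i1.const_mul _).add (i2.const_mul _)
  · refine squeeze_zero' (g := fun s : ℝ => s⁻¹) ?_ ?_ tendsto_inv_atTop_zero
    · filter_upwards [Filter.eventually_gt_atTop 0] with s hs
      positivity
    · filter_upwards [Filter.eventually_ge_atTop 1] with s hs
      rw [inv_eq_one_div, div_le_div_iff₀ (by positivity) (by positivity), one_mul, ← pow_succ]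
      calc s ^ (α + 1 + 1) ≤ s ^ (2 * m) := pow_le_pow_right₀ hs (by omega)
        _ = (s ^ 2) ^ m := by rw [pow_mul]
        _ ≤ _ := by gcongr; linarith

lemma aux_scale_fun (m α k : ℕ) (h : 2 * m = α + 1 + k) (a : ℝ) (ha : 0 < a) (r : ℝ) :
    r ^ α / (a ^ 2 + r ^ 2) ^ m
      = (a⁻¹ * (a ^ k)⁻¹) * ((a⁻¹ * r) ^ α / (1 + (a⁻¹ * r) ^ 2) ^ m) := by
  have e : 1 + (a⁻¹ * r) ^ 2 = (a ^ 2 + r ^ 2) / a ^ 2 := by field_simp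
  have hp : a ^ 2 + r ^ 2 ≠ 0 := by positivity
  rw [e, div_pow, ← pow_mul, h, mul_pow, inv_pow]
  field_simp
  ring

lemma aux_scale (m α k : ℕ) (h : 2 * m = α + 1 + k) (hk : 1 ≤ k) (a : ℝ) (ha : 0 < a) :
    IntegrableOn (fun r : ℝ => r ^ α / (a ^ 2 + r ^ 2) ^ m) (Set.Ioi 0) ∧
    ∫ r in Set.Ioi (0 : ℝ), r ^ α / (a ^ 2 + r ^ 2) ^ m = Iint m α * (a ^ k)⁻¹ := by
  simp_rw [aux_scale_fun m α k h a ha]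
  constructor
  · refine Integrable.const_mul ?_ _
    have := (integrableOn_Ioi_comp_mul_left_iff (fun s : ℝ => s ^ α / (1 + s ^ 2) ^ m) 0
      (inv_pos.mpr ha)).mpr (by simpa using aux_integrable m α (by omega))
    exact this
  · rw [integral_const_mul, integral_comp_mul_left_Ioi (fun s : ℝ => s ^ α / (1 + s ^ 2) ^ m) 0
      (inv_pos.mpr ha)]
    simp only [mul_zero, Iint, smul_eq_mul, inv_inv]
    field_simp

lemma aux_pow (p : ℕ) (hp : 2 ≤ p) :
    IntegrableOn (fun t : ℝ => ((1 + t) ^ p)⁻¹) (Set.Ioi 0) ∧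
    ∫ t in Set.Ioi (0 : ℝ), ((1 + t) ^ p)⁻¹ = ((p : ℝ) - 1)⁻¹ := by
  obtain ⟨q, rfl⟩ : ∃ q, p = q + 2 := ⟨p - 2, by omega⟩
  have hd : ∀ t ∈ Set.Ici (0 : ℝ),
      HasDerivAt (fun t : ℝ => -((q : ℝ) + 1)⁻¹ * ((1 + t) ^ (q + 1))⁻¹)
        (((1 + t) ^ (q + 2))⁻¹) t := by
    intro t ht
    have ht : 0 ≤ t := ht
    have h1 : 1 + t ≠ 0 := by positivity
    have := (((((hasDerivAt_id t).const_add 1).pow (q + 1)).inv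
      (pow_ne_zero _ h1))).const_mul (-((q : ℝ) + 1)⁻¹)
    refine this.congr_deriv ?_
    have : (q : ℝ) + 1 ≠ 0 := by positivity
    simp
    field_simp
    ring
  have hpos : ∀ t ∈ Set.Ioi (0 : ℝ), 0 ≤ ((1 + t) ^ (q + 2))⁻¹ := by
    intro t ht
    have ht : 0 < t := ht
    positivity
  have hlim : Filter.Tendsto (fun t : ℝ => -((q : ℝ) + 1)⁻¹ * ((1 + t) ^ (q + 1))⁻¹)
      Filter.atTop (nhds 0) := by
    have : Filter.Tendsto (fun t : ℝ => ((1 + t) ^ (q + 1))⁻¹) Filter.atTop (nhds 0) := by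
      refine Filter.Tendsto.inv_tendsto_atTop ?_
      exact (Filter.tendsto_pow_atTop (by omega)).comp
        (Filter.tendsto_atTop_add_const_left _ 1 Filter.tendsto_id)
    simpa using this.const_mul (-((q : ℝ) + 1)⁻¹)
  refine ⟨integrableOn_Ioi_deriv_of_nonneg' hd hpos hlim, ?_⟩
  rw [integral_Ioi_of_hasDerivAt_of_nonneg' hd hpos hlim]
  push_cast
  simp
  ring

lemma aux_space (d m k : ℕ) (hd : 1 ≤ d) (h : 2 * m = (d + 1) + 1 + k) (hk : 1 ≤ k)
    (a : ℝ) (ha : 0 < a) :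
    Integrable (fun x : EuclideanSpace ℝ (Fin d) => ‖x‖ ^ 2 / (a ^ 2 + ‖x‖ ^ 2) ^ m) ∧
    ∫ x : EuclideanSpace ℝ (Fin d), ‖x‖ ^ 2 / (a ^ 2 + ‖x‖ ^ 2) ^ m
      = sphereArea d * Iint m (d + 1) * (a ^ k)⁻¹ := by
  have : Nonempty (Fin d) := ⟨⟨0, by omega⟩⟩
  obtain ⟨hi, he⟩ := aux_scale m (d + 1) k h hk a ha
  have e : ∀ r : ℝ, r ^ (d - 1) * (r ^ 2 / (a ^ 2 + r ^ 2) ^ m)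
      = r ^ (d + 1) / (a ^ 2 + r ^ 2) ^ m := by
    intro r
    rw [← mul_div_assoc, ← pow_add]
    congr 2
    omega
  constructor
  · have := (integrable_fun_norm_addHaar (volume : Measure (EuclideanSpace ℝ (Fin d)))
      (f := fun r : ℝ => r ^ 2 / (a ^ 2 + r ^ 2) ^ m))
    rw [this]
    simpa only [finrank_euclideanSpace_fin, smul_eq_mul, e] using hi
  · have := (integral_fun_norm_addHaar (volume : Measure (EuclideanSpace ℝ (Fin d)))
      (fun r : ℝ => r ^ 2 / (a ^ 2 + r ^ 2) ^ m))
    rw [this]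
    simp only [finrank_euclideanSpace_fin, smul_eq_mul, e, he, nsmul_eq_mul, sphereArea,
      Measure.real]
    ring

lemma aux_prod (d m j p : ℕ) (hd : 1 ≤ d) (h : 2 * m = (d + 1) + 1 + (p + j)) (hp : 2 ≤ p) :
    Integrable (fun z : ℝ × EuclideanSpace ℝ (Fin d) =>
        (1 + z.1) ^ j * (‖z.2‖ ^ 2 / ((1 + z.1) ^ 2 + ‖z.2‖ ^ 2) ^ m))
      ((volume.restrict (Set.Ioi 0)).prod volume) ∧
    ∫ z : ℝ × EuclideanSpace ℝ (Fin d),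
        (1 + z.1) ^ j * (‖z.2‖ ^ 2 / ((1 + z.1) ^ 2 + ‖z.2‖ ^ 2) ^ m)
        ∂((volume.restrict (Set.Ioi 0)).prod volume)
      = sphereArea d * Iint m (d + 1) * ((p : ℝ) - 1)⁻¹ := by
  obtain ⟨hi, he⟩ := aux_pow p hp
  have hs := fun a ha => aux_space d m (p + j) hd h (by omega) a ha
  have hin : ∀ t ∈ Set.Ioi (0 : ℝ), ∫ x : EuclideanSpace ℝ (Fin d),
      (1 + t) ^ j * (‖x‖ ^ 2 / ((1 + t) ^ 2 + ‖x‖ ^ 2) ^ m)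
      = sphereArea d * Iint m (d + 1) * ((1 + t) ^ p)⁻¹ := by
    intro t ht
    have ht : 0 < t := ht
    rw [integral_const_mul, (hs (1 + t) (by positivity)).2, pow_add]
    field_simp
  have hint : Integrable (fun z : ℝ × EuclideanSpace ℝ (Fin d) =>
        (1 + z.1) ^ j * (‖z.2‖ ^ 2 / ((1 + z.1) ^ 2 + ‖z.2‖ ^ 2) ^ m))
      ((volume.restrict (Set.Ioi 0)).prod volume) := by
    rw [integrable_prod_iff]
    · constructor
      · refine (ae_restrict_iff' measurableSet_Ioi).mpr (ae_of_all _ fun t ht => ?_)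
        have ht : 0 < t := ht
        exact (hs (1 + t) (by positivity)).1.const_mul ((1 + t) ^ j)
      · refine IntegrableOn.congr_fun (hi.const_mul (sphereArea d * Iint m (d + 1))) ?_
          measurableSet_Ioi
        intro t ht
        have ht0 : 0 < t := ht
        change _ = ∫ x : EuclideanSpace ℝ (Fin d),
          ‖(1 + t) ^ j * (‖x‖ ^ 2 / ((1 + t) ^ 2 + ‖x‖ ^ 2) ^ m)‖
        change sphereArea d * Iint m (d + 1) * ((1 + t) ^ p)⁻¹ = _
        rw [← hin t ht]
        congr 1
        ext x
        rw [Real.norm_of_nonneg (by positivity)]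
    · refine Measurable.aestronglyMeasurable ?_
      fun_prop
  refine ⟨hint, ?_⟩
  rw [integral_prod _ hint]
  rw [setIntegral_congr_fun measurableSet_Ioi hin, integral_const_mul, he]

def splitEquiv (d : ℕ) :
    EuclideanSpace ℝ (Fin (d + 1)) ≃ᵐ ℝ × EuclideanSpace ℝ (Fin d) :=
  ((MeasurableEquiv.toLp 2 (Fin (d + 1) → ℝ)).symm.trans
    (MeasurableEquiv.piFinSuccAbove (fun _ => ℝ) (Fin.last d))).trans
    ((MeasurableEquiv.refl ℝ).prodCongr (MeasurableEquiv.toLp 2 (Fin d → ℝ)))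

lemma splitEquiv_mp (d : ℕ) : MeasurePreserving (splitEquiv d) := by
  have h1 := PiLp.volume_preserving_ofLp (Fin (d + 1))
  have h2 := volume_preserving_piFinSuccAbove (fun _ : Fin (d + 1) => ℝ) (Fin.last d)
  have h3 := (MeasurePreserving.id (volume : Measure ℝ)).prod
    (PiLp.volume_preserving_toLp (Fin d))
  exact h3.comp (h2.comp h1)

lemma splitEquiv_fst (d : ℕ) (y : EuclideanSpace ℝ (Fin (d + 1))) :
    (splitEquiv d y).1 = lastCoord (d + 1) y := rfl

lemma splitEquiv_snd (d : ℕ) (y : EuclideanSpace ℝ (Fin (d + 1))) :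
    ‖(splitEquiv d y).2‖ ^ 2 = barNormSq (d + 1) y := by
  have : ∀ i, (splitEquiv d y).2 i = y (Fin.castSucc i) := by
    intro i
    change y ((Fin.last d).succAbove i) = _
    rw [Fin.succAbove_last]
  rw [EuclideanSpace.norm_sq_eq, barNormSq, Fin.sum_univ_castSucc]
  simp [this]

lemma norm_sq_split (d : ℕ) (y : EuclideanSpace ℝ (Fin (d + 1))) :
    ‖y‖ ^ 2 = barNormSq (d + 1) y + lastCoord (d + 1) y ^ 2 := by
  rw [EuclideanSpace.norm_sq_eq, barNormSq, Fin.sum_univ_castSucc, Fin.sum_univ_castSucc]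
  simp [lastCoord, lastIdx, Fin.last]

/-- `∫_{ℝⁿ₊} L₃ |ȳ|² dy = ω_{n-2} · 16(n-1)/((n-3)(n-5)(n-6)) · Iₙⁿ`. -/
theorem statement14 (n : ℕ) [NeZero n] (hn : 7 ≤ n) :
    ∫ y in halfSpace n, L3 n y * barNormSq n y
      = sphereArea (n - 1)
          * (16 * ((n : ℝ) - 1) / (((n : ℝ) - 3) * ((n : ℝ) - 5) * ((n : ℝ) - 6)))
          * Iint n n := by
  obtain ⟨d, rfl⟩ : ∃ d, n = d + 1 := ⟨n - 1, by omega⟩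
  obtain ⟨i1, e1⟩ := aux_prod d (d - 1) 0 (d - 4) (by omega) (by omega) (by omega)
  obtain ⟨i2, e2⟩ := aux_prod d d 1 (d - 3) (by omega) (by omega) (by omega)
  have hset : halfSpace (d + 1) =
      splitEquiv d ⁻¹' ((Set.Ici (0 : ℝ)) ×ˢ (Set.univ : Set (EuclideanSpace ℝ (Fin d)))) := by
    ext y
    simp [halfSpace, splitEquiv_fst]
  have hfun : ∀ y ∈ halfSpace (d + 1), L3 (d + 1) y * barNormSq (d + 1) y =
      (fun z : ℝ × EuclideanSpace ℝ (Fin d) =>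
        (1 + z.1) ^ 0 * (‖z.2‖ ^ 2 / ((1 + z.1) ^ 2 + ‖z.2‖ ^ 2) ^ (d - 1))
        - 2 * ((1 + z.1) ^ 1 * (‖z.2‖ ^ 2 / ((1 + z.1) ^ 2 + ‖z.2‖ ^ 2) ^ d)))
        (splitEquiv d y) := by
    intro y hy
    have hy : 0 ≤ lastCoord (d + 1) y := hy
    have hb : 0 ≤ barNormSq (d + 1) y := by rw [← splitEquiv_snd]; positivity
    simp only [splitEquiv_snd, splitEquiv_fst, L3, norm_sq_split]
    obtain ⟨k, rfl⟩ : ∃ k, d = k + 1 := ⟨d - 1, by omega⟩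
    simp only [Nat.add_sub_cancel]
    generalize lastCoord (k + 1 + 1) y = t at *
    generalize barNormSq (k + 1 + 1) y = b at *
    have : (1 + t) ^ 2 + b ≠ 0 := by positivity
    field_simp
    ring
  have hmeas : MeasurableSet (halfSpace (d + 1)) := by
    rw [hset]
    exact (splitEquiv d).measurable (measurableSet_Ici.prod MeasurableSet.univ)
  rw [setIntegral_congr_fun hmeas hfun, hset,
    (splitEquiv_mp d).setIntegral_preimage_emb (splitEquiv d).measurableEmbedding
      (fun z : ℝ × EuclideanSpace ℝ (Fin d) =>
        (1 + z.1) ^ 0 * (‖z.2‖ ^ 2 / ((1 + z.1) ^ 2 + ‖z.2‖ ^ 2) ^ (d - 1))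
        - 2 * ((1 + z.1) ^ 1 * (‖z.2‖ ^ 2 / ((1 + z.1) ^ 2 + ‖z.2‖ ^ 2) ^ d))),
    Measure.volume_eq_prod, ← Measure.prod_restrict, Measure.restrict_univ,
    ← Measure.restrict_congr_set (Ioi_ae_eq_Ici (a := (0 : ℝ))), integral_sub i1 (i2.const_mul 2), integral_const_mul, e1, e2]
  have r1 := aux_rec (d - 1) (d + 1) (by omega)
  have r2 := aux_rec d (d + 1) (by omega)
  rw [Nat.sub_add_cancel (by omega)] at r1
  rw [Nat.cast_sub (by omega)] at r1
  rw [Nat.cast_sub (by omega), Nat.cast_sub (by omega), Nat.add_sub_cancel]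
  push_cast at *
  have hd : (6 : ℝ) ≤ d := by exact_mod_cast (by omega : 6 ≤ d)
  generalize (d : ℝ) = D at *
  have h2 : D - 2 ≠ 0 := by linarith
  have h4 : D - 4 ≠ 0 := by linarith
  have h5 : D - 5 ≠ 0 := by linarith
  have s2 : Iint d (d + 1) = 2 * D * Iint (d + 1) (d + 1) / (D - 2) := by
    rw [eq_div_iff h2]; linarith
  have s1 : Iint (d - 1) (d + 1) = 2 * (D - 1) * Iint d (d + 1) / (D - 4) := by
    rw [eq_div_iff h4]; linarith
  rw [s1, s2]
  have t1 : D - 4 - 1 = D - 5 := by ring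
  have t2 : D - 3 - 1 = D - 4 := by ring
  have t3 : D + 1 - 3 = D - 2 := by ring
  have t4 : D + 1 - 5 = D - 4 := by ring
  have t5 : D + 1 - 6 = D - 5 := by ring
  have t6 : D + 1 - 1 = D := by ring
  rw [t1, t2, t3, t4, t5, t6]
  field_simp
  ring
end
end
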